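/- arXiv:2508.07643 — 5 statements merged into one kernel-verified Lean document; each statement's English description precedes it below -/
import Mathlib

section
/- Assume Hypothesis (χ) for χ, χ̄ and Hypothesis (T) for T, and suppose additionally that the restriction T_χ of T to 𝔥_χ is bounded. Then S := T P_χ̄ also satisfies Hypothesis (T), and the smooth Feshbach–Schur maps F_{χ,T} and F_{χ, T P_χ̄} coincide: they have the same domain, and F_{χ,T}(H) = F_{χ, T P_χ̄}(H) for every H in this common domain. -/
open ContinuousLinearMap

noncomputable section

variable {𝔥 : Type*} [NormedAddCommGroup 𝔥] [InnerProductSpace ℂ 𝔥] [CompleteSpace 𝔥]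

/-- Hypothesis (χ): `χ` and `χ̄` are bounded, self-adjoint, positive, mutually
commuting operators with `χ² + χ̄² = 1`, together with the orthogonal projections
`Pχ`, `Pχc` onto the closures `𝔥_χ`, `𝔥_χ̄` of their ranges. -/
structure ChiSetup (𝔥 : Type*) [NormedAddCommGroup 𝔥] [InnerProductSpace ℂ 𝔥]
    [CompleteSpace 𝔥] where
  χ : 𝔥 →L[ℂ] 𝔥
  χc : 𝔥 →L[ℂ] 𝔥
  Pχ : 𝔥 →L[ℂ] 𝔥
  Pχc : 𝔥 →L[ℂ] 𝔥
  χ_pos : χ.IsPositive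
  χc_pos : χc.IsPositive
  comm_χχc : χ ∘L χc = χc ∘L χ
  sum_sq : χ ∘L χ + χc ∘L χc = 1
  Pχ_sa : IsSelfAdjoint Pχ
  Pχ_idem : Pχ ∘L Pχ = Pχ
  Pχ_mem : ∀ x : 𝔥, Pχ x ∈ (LinearMap.range (χ : 𝔥 →ₗ[ℂ] 𝔥)).topologicalClosure
  Pχ_fix : ∀ x ∈ (LinearMap.range (χ : 𝔥 →ₗ[ℂ] 𝔥)).topologicalClosure, Pχ x = x
  Pχc_sa : IsSelfAdjoint Pχc
  Pχc_idem : Pχc ∘L Pχc = Pχc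
  Pχc_mem : ∀ x : 𝔥, Pχc x ∈ (LinearMap.range (χc : 𝔥 →ₗ[ℂ] 𝔥)).topologicalClosure
  Pχc_fix : ∀ x ∈ (LinearMap.range (χc : 𝔥 →ₗ[ℂ] 𝔥)).topologicalClosure, Pχc x = x

namespace ChiSetup

variable (c : ChiSetup 𝔥)

/-- `𝔥_χ`, the closure of the range of `χ`. -/
def Kχ : Submodule ℂ 𝔥 := (LinearMap.range (c.χ : 𝔥 →ₗ[ℂ] 𝔥)).topologicalClosure

/-- `𝔥_χ̄`, the closure of the range of `χ̄`. -/
def Kχc : Submodule ℂ 𝔥 := (LinearMap.range (c.χc : 𝔥 →ₗ[ℂ] 𝔥)).topologicalClosure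

end ChiSetup

/-- `R` is a bounded (everywhere defined on `K`) two-sided inverse of the restriction
of the (possibly unbounded) operator `A`, with domain `D`, to `D ⊓ K`, viewed as an
operator in the closed subspace `K`; this encodes bounded invertibility on `K`. -/
def IsBddInvOn (A : 𝔥 →ₗ[ℂ] 𝔥) (D K : Submodule ℂ 𝔥) (R : 𝔥 →L[ℂ] 𝔥) : Prop :=
  (∀ x, x ∈ D → x ∈ K → A x ∈ K) ∧
  (∀ y ∈ K, R y ∈ D ∧ R y ∈ K ∧ A (R y) = y) ∧
  (∀ x, x ∈ D → x ∈ K → R (A x) = x)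

/-- The restriction of `A` (with domain `D`) to `K` is bounded invertible on `K`. -/
def BddInvOn (A : 𝔥 →ₗ[ℂ] 𝔥) (D K : Submodule ℂ 𝔥) : Prop :=
  ∃ R : 𝔥 →L[ℂ] 𝔥, IsBddInvOn A D K R

/-- Hypothesis (T) for a closed, densely defined operator `T` with domain `D`. -/
structure HypT (c : ChiSetup 𝔥) (D : Submodule ℂ 𝔥) (T : 𝔥 →ₗ[ℂ] 𝔥) : Prop where
  dense : Dense (D : Set 𝔥)
  closedGraph : IsClosed {p : 𝔥 × 𝔥 | p.1 ∈ D ∧ T p.1 = p.2}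
  mapχ : ∀ x ∈ D, c.χ x ∈ D
  mapχc : ∀ x ∈ D, c.χc x ∈ D
  mapPχ : ∀ x ∈ D, c.Pχ x ∈ D
  mapPχc : ∀ x ∈ D, c.Pχc x ∈ D
  commχ : ∀ x ∈ D, c.χ (T x) = T (c.χ x)
  commχc : ∀ x ∈ D, c.χc (T x) = T (c.χc x)
  invχc : BddInvOn T D c.Kχc

/-- The operator `H_{χ̄,T} = T_χ̄ + χ̄ W_T χ̄` (with `W_T = H − T`). -/
def Hbar (c : ChiSetup 𝔥) (T H : 𝔥 →ₗ[ℂ] 𝔥) : 𝔥 →ₗ[ℂ] 𝔥 :=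
  T + (c.χc : 𝔥 →ₗ[ℂ] 𝔥) ∘ₗ (H - T) ∘ₗ (c.χc : 𝔥 →ₗ[ℂ] 𝔥)

/-- `H` belongs to the domain of the smooth Feshbach–Schur map `F_{χ,T}`. -/
structure MemDomF (c : ChiSetup 𝔥) (D : Submodule ℂ 𝔥) (T H : 𝔥 →ₗ[ℂ] 𝔥) : Prop where
  graph_equiv : ∃ C : ℝ, 0 < C ∧ ∀ x ∈ D,
    C * (‖T x‖ + ‖x‖) ≤ ‖H x‖ + ‖x‖ ∧ ‖H x‖ + ‖x‖ ≤ C⁻¹ * (‖T x‖ + ‖x‖)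
  inv : BddInvOn (Hbar c T H) D c.Kχc
  bdd : ∀ R : 𝔥 →L[ℂ] 𝔥, IsBddInvOn (Hbar c T H) D c.Kχc R →
    ∃ C : ℝ, ∀ x, x ∈ D → x ∈ c.Kχ →
      ‖c.χc (R (c.χc ((H - T) (c.χ x))))‖ ≤ C * ‖x‖

/-- The smooth Feshbach–Schur map `F_{χ,T}(H) = T_χ + χ W_T χ − χ W_T χ̄ H_{χ̄,T}⁻¹ χ̄ W_T χ`,
computed with a chosen bounded inverse `R` of `H_{χ̄,T}` on `𝔥_χ̄`. -/
def Fes (c : ChiSetup 𝔥) (T H : 𝔥 →ₗ[ℂ] 𝔥) (R : 𝔥 →L[ℂ] 𝔥) : 𝔥 →ₗ[ℂ] 𝔥 :=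
  T + (c.χ : 𝔥 →ₗ[ℂ] 𝔥) ∘ₗ (H - T) ∘ₗ (c.χ : 𝔥 →ₗ[ℂ] 𝔥)
    - (c.χ : 𝔥 →ₗ[ℂ] 𝔥) ∘ₗ (H - T) ∘ₗ (c.χc : 𝔥 →ₗ[ℂ] 𝔥) ∘ₗ (R : 𝔥 →ₗ[ℂ] 𝔥)
        ∘ₗ (c.χc : 𝔥 →ₗ[ℂ] 𝔥) ∘ₗ (H - T) ∘ₗ (c.χ : 𝔥 →ₗ[ℂ] 𝔥)

namespace ChiSetup

variable (c : ChiSetup 𝔥)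

theorem χ_mem_Kχ (x : 𝔥) : c.χ x ∈ c.Kχ :=
  Submodule.le_topologicalClosure _ ⟨x, rfl⟩

theorem χc_mem_Kχc (x : 𝔥) : c.χc x ∈ c.Kχc :=
  Submodule.le_topologicalClosure _ ⟨x, rfl⟩

theorem Pχc_χc (x : 𝔥) : c.Pχc (c.χc x) = c.χc x :=
  c.Pχc_fix _ (c.χc_mem_Kχc x)

theorem χc_Pχc (x : 𝔥) : c.χc (c.Pχc x) = c.χc x := by
  have h : c.Pχc * c.χc = c.χc := ContinuousLinearMap.ext c.Pχc_χc
  have h' := congrArg star h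
  rw [star_mul, c.Pχc_sa.star_eq, c.χc_pos.isSelfAdjoint.star_eq] at h'
  exact DFunLike.congr_fun h' x

theorem χ_eq_self_of_χc_eq_zero {x : 𝔥} (hx : c.χc x = 0) : c.χ x = x := by
  have h1 : c.χ (c.χ x) = x := by
    simpa [hx] using DFunLike.congr_fun c.sum_sq x
  have h2 : c.χ (c.χ x - x) = -(c.χ x - x) := by
    rw [map_sub, h1]; abel
  have h3 := c.χ_pos.re_inner_nonneg_left (c.χ x - x)
  rw [h2, inner_neg_left, map_neg, inner_self_eq_norm_sq] at h3
  have h4 : ‖c.χ x - x‖ = 0 := by nlinarith [norm_nonneg (c.χ x - x)]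
  exact sub_eq_zero.mp (norm_eq_zero.mp h4)

theorem χc_sub_Pχc (x : 𝔥) : c.χc (x - c.Pχc x) = 0 := by
  rw [map_sub, c.χc_Pχc, sub_self]

theorem χ_sub_Pχc (x : 𝔥) : c.χ (x - c.Pχc x) = x - c.Pχc x :=
  c.χ_eq_self_of_χc_eq_zero (c.χc_sub_Pχc x)

theorem χ_self_sub_Pχc_χ (x : 𝔥) : c.χ x - c.Pχc (c.χ x) = x - c.Pχc x := by
  have h : c.χ * (1 - c.Pχc) = 1 - c.Pχc := ContinuousLinearMap.ext c.χ_sub_Pχc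
  have h' := congrArg star h
  rw [star_mul, star_sub, star_one, c.Pχc_sa.star_eq, c.χ_pos.isSelfAdjoint.star_eq] at h'
  exact DFunLike.congr_fun h' x

theorem Pχc_χ (x : 𝔥) : c.Pχc (c.χ x) = c.χ (c.Pχc x) := by
  have h := c.χ_sub_Pχc x
  rw [map_sub, ← c.χ_self_sub_Pχc_χ x] at h
  exact (sub_right_injective h).symm

theorem sub_Pχc_mem_Kχ (x : 𝔥) : x - c.Pχc x ∈ c.Kχ :=
  c.χ_sub_Pχc x ▸ c.χ_mem_Kχ _

end ChiSetup

set_option linter.unusedSectionVars false in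
theorem IsBddInvOn.congr {A B : 𝔥 →ₗ[ℂ] 𝔥} {D K : Submodule ℂ 𝔥} {R : 𝔥 →L[ℂ] 𝔥}
    (h : IsBddInvOn A D K R) (hAB : ∀ x ∈ D, x ∈ K → A x = B x) : IsBddInvOn B D K R := by
  obtain ⟨h1, h2, h3⟩ := h
  refine ⟨fun x hD hK => hAB x hD hK ▸ h1 x hD hK, fun y hy => ?_,
    fun x hD hK => hAB x hD hK ▸ h3 x hD hK⟩
  obtain ⟨hD, hK, he⟩ := h2 y hy
  exact ⟨hD, hK, hAB _ hD hK ▸ he⟩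

set_option linter.unusedSectionVars false in
theorem IsBddInvOn.eqOn {A : 𝔥 →ₗ[ℂ] 𝔥} {D K : Submodule ℂ 𝔥} {R R' : 𝔥 →L[ℂ] 𝔥}
    (h : IsBddInvOn A D K R) (h' : IsBddInvOn A D K R') {y : 𝔥} (hy : y ∈ K) : R y = R' y := by
  obtain ⟨hD, hK, he⟩ := h.2.1 y hy
  simpa only [he] using (h'.2.2 _ hD hK).symm

theorem Hbar_eq_of_eqOn_Kχc {c : ChiSetup 𝔥} {T S : 𝔥 →ₗ[ℂ] 𝔥} {x : 𝔥}
    (hx : T x = S x) (hc : T (c.χc x) = S (c.χc x)) (H : 𝔥 →ₗ[ℂ] 𝔥) :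
    Hbar c T H x = Hbar c S H x := by
  simp [Hbar, hx, hc]

/-- Membership in the domain of the smooth Feshbach–Schur map only depends on `T` up to a
bounded perturbation vanishing on `𝔥_χ̄` and annihilated by `χ̄ · χ`. -/
theorem MemDomF.congr {c : ChiSetup 𝔥} {D : Submodule ℂ 𝔥} {T S H : 𝔥 →ₗ[ℂ] 𝔥}
    (h : MemDomF c D T H) (hc : ∀ x, T (c.χc x) = S (c.χc x))
    (hK : ∀ x ∈ D, x ∈ c.Kχc → T x = S x)
    (hχ : ∀ x ∈ D, c.χc (T (c.χ x)) = c.χc (S (c.χ x)))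
    {M : ℝ} (hM : 0 ≤ M) (hb : ∀ x ∈ D, ‖T x - S x‖ ≤ M * ‖x‖) : MemDomF c D S H := by
  have hH : ∀ x ∈ D, x ∈ c.Kχc → Hbar c T H x = Hbar c S H x :=
    fun x hD hx => Hbar_eq_of_eqOn_Kχc (hK x hD hx) (hc x) H
  refine ⟨?_, ?_, fun R hR => ?_⟩
  · obtain ⟨C, hC, hCx⟩ := h.graph_equiv
    have hM1 : 0 < 1 + M := by linarith
    refine ⟨C / (1 + M), div_pos hC hM1, fun x hx => ?_⟩
    obtain ⟨h1, h2⟩ := hCx x hx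
    have hn := norm_nonneg x
    have hTS := hb x hx
    have a1 := norm_sub_norm_le (T x) (S x)
    have a2 := norm_sub_norm_le (S x) (T x)
    rw [norm_sub_rev] at a2
    have b1 : ‖T x‖ + ‖x‖ ≤ (1 + M) * (‖S x‖ + ‖x‖) := by
      nlinarith [mul_nonneg hM (norm_nonneg (S x))]
    have b2 : ‖S x‖ + ‖x‖ ≤ (1 + M) * (‖T x‖ + ‖x‖) := by
      nlinarith [mul_nonneg hM (norm_nonneg (T x))]
    constructor
    · calc C / (1 + M) * (‖S x‖ + ‖x‖) ≤ C / (1 + M) * ((1 + M) * (‖T x‖ + ‖x‖)) := by gcongr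
        _ = C * (‖T x‖ + ‖x‖) := by field_simp
        _ ≤ _ := h1
    · calc ‖H x‖ + ‖x‖ ≤ C⁻¹ * (‖T x‖ + ‖x‖) := h2
        _ ≤ C⁻¹ * ((1 + M) * (‖S x‖ + ‖x‖)) := by gcongr
        _ = (C / (1 + M))⁻¹ * (‖S x‖ + ‖x‖) := by field_simp
  · obtain ⟨R, hR⟩ := h.inv
    exact ⟨R, hR.congr hH⟩
  · obtain ⟨C, hC⟩ := h.bdd R (hR.congr fun x hD hx => (hH x hD hx).symm)
    refine ⟨C, fun x hD hx => ?_⟩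
    have := hC x hD hx
    rwa [LinearMap.sub_apply, map_sub c.χc, hχ x hD, ← map_sub c.χc,
      ← LinearMap.sub_apply] at this

namespace HypT

variable {c : ChiSetup 𝔥} {D : Submodule ℂ 𝔥} {T : 𝔥 →ₗ[ℂ] 𝔥}

theorem sub_Pχc_mem (hT : HypT c D T) {x : 𝔥} (hx : x ∈ D) : x - c.Pχc x ∈ D :=
  D.sub_mem hx (hT.mapPχc x hx)

theorem χc_map_χ_Pχc (hT : HypT c D T) {x : 𝔥} (hx : x ∈ D) :
    c.χc (T (c.χ x)) = c.χc (T (c.Pχc (c.χ x))) := by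
  have h := hT.commχc _ (hT.sub_Pχc_mem (hT.mapχ x hx))
  rwa [c.χc_sub_Pχc, map_zero, map_sub, map_sub, sub_eq_zero] at h

theorem χ_map_χ_sub_Pχc (hT : HypT c D T) {x : 𝔥} (hx : x ∈ D) :
    c.χ (T (c.χ x - c.Pχc (c.χ x))) = T (x - c.Pχc x) := by
  rw [c.χ_self_sub_Pχc_χ, hT.commχ _ (hT.sub_Pχc_mem hx), c.χ_sub_Pχc]

/-- If `T` is bounded on `𝔥_χ`, then `T P_χ̄` is a bounded perturbation of `T`. -/
theorem exists_bound_sub_Pχc (hT : HypT c D T)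
    (hb : ∃ C : ℝ, ∀ x, x ∈ D → x ∈ c.Kχ → ‖T x‖ ≤ C * ‖x‖) :
    ∃ M : ℝ, 0 ≤ M ∧ ∀ x ∈ D, ‖T (x - c.Pχc x)‖ ≤ M * ‖x‖ := by
  obtain ⟨C, hC⟩ := hb
  refine ⟨|C| * ‖1 - c.Pχc‖, by positivity, fun x hx => ?_⟩
  calc ‖T (x - c.Pχc x)‖ ≤ C * ‖x - c.Pχc x‖ := hC _ (hT.sub_Pχc_mem hx) (c.sub_Pχc_mem_Kχ x)
    _ ≤ |C| * ‖x - c.Pχc x‖ := by gcongr; exact le_abs_self C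
    _ ≤ |C| * (‖1 - c.Pχc‖ * ‖x‖) := by gcongr; exact (1 - c.Pχc).le_opNorm x
    _ = _ := by ring

open Filter Topology in
theorem comp_Pχc (hT : HypT c D T)
    (hb : ∃ C : ℝ, ∀ x, x ∈ D → x ∈ c.Kχ → ‖T x‖ ≤ C * ‖x‖) :
    HypT c D (T ∘ₗ (c.Pχc : 𝔥 →ₗ[ℂ] 𝔥)) where
  dense := hT.dense
  closedGraph := by
    obtain ⟨M, hM, hMx⟩ := hT.exists_bound_sub_Pχc hb
    refine IsSeqClosed.isClosed fun u p hu hup => ?_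
    obtain ⟨hx, hy⟩ := (Prod.tendsto_iff _ _).mp hup
    have hP : c.Pχc p.1 ∈ D ∧ T (c.Pχc p.1) = p.2 := by
      refine hT.closedGraph.mem_of_tendsto
        ((((c.Pχc.continuous.tendsto _).comp hx)).prodMk_nhds hy)
        (Eventually.of_forall fun n => ⟨hT.mapPχc _ (hu n).1, (hu n).2⟩)
    let v : ℕ → 𝔥 := fun n => T ((u n).1 - c.Pχc (u n).1)
    have hv : CauchySeq v := by
      have hxc := hx.cauchySeq
      rw [Metric.cauchySeq_iff] at hxc ⊢
      intro ε hε
      obtain ⟨N, hN⟩ := hxc (ε / (M + 1)) (by positivity)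
      refine ⟨N, fun m hm n hn => ?_⟩
      have h1 := hN m hm n hn
      rw [dist_eq_norm, lt_div_iff₀ (by positivity)] at h1
      have h2 := hMx _ (D.sub_mem (hu m).1 (hu n).1)
      have h3 : v m - v n = T ((u m).1 - (u n).1 - c.Pχc ((u m).1 - (u n).1)) := by
        simp only [v, map_sub]; abel
      rw [dist_eq_norm, h3]
      nlinarith [norm_nonneg ((u m).1 - (u n).1)]
    obtain ⟨z, hz⟩ := cauchySeq_tendsto_of_complete hv
    have hQ : p.1 - c.Pχc p.1 ∈ D ∧ T (p.1 - c.Pχc p.1) = z :=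
      hT.closedGraph.mem_of_tendsto
        ((hx.sub ((c.Pχc.continuous.tendsto _).comp hx)).prodMk_nhds hz)
        (Eventually.of_forall fun n => ⟨hT.sub_Pχc_mem (hu n).1, rfl⟩)
    exact ⟨by simpa using D.add_mem hQ.1 hP.1, hP.2⟩
  mapχ := hT.mapχ
  mapχc := hT.mapχc
  mapPχ := hT.mapPχ
  mapPχc := hT.mapPχc
  commχ x hx := by
    simp [hT.commχ _ (hT.mapPχc x hx), c.Pχc_χ]
  commχc x hx := by
    simp [hT.commχc _ (hT.mapPχc x hx), c.Pχc_χc, c.χc_Pχc]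
  invχc := by
    obtain ⟨R, hR⟩ := hT.invχc
    exact ⟨R, hR.congr fun x _ hK => by simp [c.Pχc_fix x hK]⟩

theorem Fes_comp_Pχc (hT : HypT c D T) (H : 𝔥 →ₗ[ℂ] 𝔥) {R R' : 𝔥 →L[ℂ] 𝔥}
    (hR : ∀ y ∈ c.Kχc, R y = R' y) {x : 𝔥} (hx : x ∈ D) :
    Fes c T H R x = Fes c (T ∘ₗ (c.Pχc : 𝔥 →ₗ[ℂ] 𝔥)) H R' x := by
  have h1 := hT.χ_map_χ_sub_Pχc hx
  simp only [map_sub] at h1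
  have h2 := hT.χc_map_χ_Pχc hx
  have h3 : R (c.χc (H (c.χ x) - T (c.χ x))) = R' (c.χc (H (c.χ x) - T (c.Pχc (c.χ x)))) := by
    rw [hR _ (c.χc_mem_Kχc _), map_sub c.χc, h2, ← map_sub c.χc]
  simp only [Fes, LinearMap.sub_apply, LinearMap.add_apply, LinearMap.comp_apply,
    ContinuousLinearMap.coe_coe, h3, c.Pχc_χc]
  congr 1
  rw [← sub_eq_zero] at h1
  rw [map_sub, map_sub, ← sub_eq_zero, ← neg_eq_zero, ← h1]
  abel

end HypT

/-- Corollary: if `T` satisfies Hypothesis (T) and its restriction `T_χ`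
to `𝔥_χ` is bounded, then `S := T P_χ̄` also satisfies Hypothesis (T) and the smooth
Feshbach–Schur maps `F_{χ,T}` and `F_{χ,T P_χ̄}` coincide: they have the same domain, and
their values agree on `𝔇_χ` for every `H` in the common domain. -/
theorem smooth_feshbach_map_eq_of_TPchibar
    (c : ChiSetup 𝔥) (D : Submodule ℂ 𝔥) (T : 𝔥 →ₗ[ℂ] 𝔥)
    (hT : HypT c D T)
    (hTχ_bdd : ∃ C : ℝ, ∀ x, x ∈ D → x ∈ c.Kχ → ‖T x‖ ≤ C * ‖x‖) :
    HypT c D (T ∘ₗ (c.Pχc : 𝔥 →ₗ[ℂ] 𝔥)) ∧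
    ∀ H : 𝔥 →ₗ[ℂ] 𝔥, IsClosed {p : 𝔥 × 𝔥 | p.1 ∈ D ∧ H p.1 = p.2} →
      (MemDomF c D T H ↔ MemDomF c D (T ∘ₗ (c.Pχc : 𝔥 →ₗ[ℂ] 𝔥)) H) ∧
      ∀ RT RS : 𝔥 →L[ℂ] 𝔥,
        IsBddInvOn (Hbar c T H) D c.Kχc RT →
        IsBddInvOn (Hbar c (T ∘ₗ (c.Pχc : 𝔥 →ₗ[ℂ] 𝔥)) H) D c.Kχc RS →
        ∀ x, x ∈ D → x ∈ c.Kχ →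
          Fes c T H RT x = Fes c (T ∘ₗ (c.Pχc : 𝔥 →ₗ[ℂ] 𝔥)) H RS x := by
  refine ⟨hT.comp_Pχc hTχ_bdd, fun H _ => ?_⟩
  obtain ⟨M, hM, hMx⟩ := hT.exists_bound_sub_Pχc hTχ_bdd
  have hc : ∀ x, T (c.χc x) = (T ∘ₗ (c.Pχc : 𝔥 →ₗ[ℂ] 𝔥)) (c.χc x) := fun x => by
    simp [c.Pχc_χc]
  have hK : ∀ x ∈ D, x ∈ c.Kχc → T x = (T ∘ₗ (c.Pχc : 𝔥 →ₗ[ℂ] 𝔥)) x := fun x _ hx => by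
    simp [c.Pχc_fix x hx]
  have hb : ∀ x ∈ D, ‖T x - (T ∘ₗ (c.Pχc : 𝔥 →ₗ[ℂ] 𝔥)) x‖ ≤ M * ‖x‖ := fun x hx => by
    simpa using hMx x hx
  refine ⟨⟨fun h => h.congr hc hK (fun x hx => hT.χc_map_χ_Pχc hx) hM hb,
    fun h => h.congr (fun x => (hc x).symm) (fun x hD hx => (hK x hD hx).symm)
      (fun x hx => (hT.χc_map_χ_Pχc hx).symm) hM
      fun x hx => by rw [norm_sub_rev]; exact hb x hx⟩, fun RT RS hRT hRS x hx _ => ?_⟩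
  have hRT' := hRT.congr fun x hD hx => Hbar_eq_of_eqOn_Kχc (hK x hD hx) (hc x) H
  exact hT.Fes_comp_Pχc H (fun y hy => hRT'.eqOn hRS hy) hx

end
end

section
/- Let S and T be closed, densely defined operators with common domain 𝔇, each satisfying Hypothesis (T), with T P_{χχ̄} = S P_{χχ̄} on 𝔇, and let H be a closed operator with domain 𝔇 in the domain of F_{χ,T}. Then, writing W_T := H − T and W_S := H − S: (i) χ W_T χ̄ = χ W_S χ̄ and χ̄ W_T χ = χ̄ W_S χ on 𝔇; and (ii) H_{χ̄,S} := S_χ̄ + χ̄ W_S χ̄ equals H_{χ̄,T} := T_χ̄ + χ̄ W_T χ̄ on 𝔇_χ̄ := P_χ̄𝔇. -/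
open ContinuousLinearMap

noncomputable section

variable {𝔥 : Type*} [NormedAddCommGroup 𝔥] [InnerProductSpace ℂ 𝔥] [CompleteSpace 𝔥]

namespace ChiSetup

variable (c : ChiSetup 𝔥)

theorem χ_χc_apply (x : 𝔥) : c.χ (c.χc x) = c.χc (c.χ x) :=
  DFunLike.congr_fun c.comm_χχc x

theorem χ_χ_apply (x : 𝔥) : c.χ (c.χ x) = x - c.χc (c.χc x) :=
  eq_sub_of_add_eq (DFunLike.congr_fun c.sum_sq x)

end ChiSetup

/-- if `S` and `T` both satisfy Hypothesis (T) with common domain `D`,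
agree on `𝔥_{χχ̄}`, and `H` is in the domain of `F_{χ,T}`, then (i) `χ W_T χ̄ = χ W_S χ̄`
and `χ̄ W_T χ = χ̄ W_S χ` on `D`, and (ii) `H_{χ̄,S} = H_{χ̄,T}` on `𝔇_χ̄ = D ⊓ 𝔥_χ̄`. -/
theorem smooth_feshbach_W_exchange
    (c : ChiSetup 𝔥) (D : Submodule ℂ 𝔥) (S T H : 𝔥 →ₗ[ℂ] 𝔥)
    (hS : HypT c D S) (hT : HypT c D T)
    (hHclosed : IsClosed {p : 𝔥 × 𝔥 | p.1 ∈ D ∧ H p.1 = p.2})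
    (hST : ∀ x, x ∈ D → x ∈ c.Kχ → x ∈ c.Kχc → T x = S x)
    (hH : MemDomF c D T H) :
    (∀ x ∈ D, c.χ ((H - T) (c.χc x)) = c.χ ((H - S) (c.χc x))) ∧
    (∀ x ∈ D, c.χc ((H - T) (c.χ x)) = c.χc ((H - S) (c.χ x))) ∧
    (∀ x, x ∈ D → x ∈ c.Kχc → Hbar c S H x = Hbar c T H x) := by
  have hχχc : ∀ x ∈ D, T (c.χ (c.χc x)) = S (c.χ (c.χc x)) := fun x hx =>
    hST _ (hT.mapχ _ (hT.mapχc x hx)) (c.χ_mem_Kχ _) (c.χ_χc_apply x ▸ c.χc_mem_Kχc _)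
  refine ⟨fun x hx => ?_, fun x hx => ?_, fun x hx hxc => ?_⟩
  · simp only [LinearMap.sub_apply, map_sub]
    rw [hT.commχ _ (hT.mapχc x hx), hS.commχ _ (hT.mapχc x hx), hχχc x hx]
  · simp only [LinearMap.sub_apply, map_sub]
    rw [hT.commχc _ (hT.mapχ x hx), hS.commχc _ (hT.mapχ x hx), ← c.χ_χc_apply, hχχc x hx]
  · have hχχ : T (c.χ (c.χ x)) = S (c.χ (c.χ x)) := by
      refine hST _ (hT.mapχ _ (hT.mapχ x hx)) (c.χ_mem_Kχ _) ?_
      rw [c.χ_χ_apply]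
      exact c.Kχc.sub_mem hxc (c.χc_mem_Kχc _)
    rw [c.χ_χ_apply, map_sub, map_sub] at hχχ
    simp only [Hbar, LinearMap.add_apply, LinearMap.comp_apply, LinearMap.sub_apply,
      ContinuousLinearMap.coe_coe, map_sub]
    rw [hT.commχc _ (hT.mapχc x hx), hS.commχc _ (hT.mapχc x hx),
      add_sub_left_comm (S x), add_sub_left_comm (T x), hχχ]

end
end

section
/- Suppose H (a closed operator with domain 𝔇) belongs to the domain of F_{χ,T}. Then H is bounded invertible on 𝔥 if and only if F_{χ,T}(H) : 𝔇_χ → 𝔥_χ is bounded invertible on 𝔥_χ. In either case, F_{χ,T}(H)^{-1} = [χ H^{-1} χ + χ̄ (T_χ̄)^{-1} χ̄]|_{𝔥_χ}, and moreover dim ker(H) = dim ker(F_{χ,T}(H)). -/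
open ContinuousLinearMap

noncomputable section

variable {𝔥 : Type*} [NormedAddCommGroup 𝔥] [InnerProductSpace ℂ 𝔥] [CompleteSpace 𝔥]

namespace ChiSetup

variable (c : ChiSetup 𝔥)

theorem isClosed_Kχ : IsClosed (c.Kχ : Set 𝔥) :=
  Submodule.isClosed_topologicalClosure _

theorem isClosed_Kχc : IsClosed (c.Kχc : Set 𝔥) :=
  Submodule.isClosed_topologicalClosure _

theorem sum_sq_apply (x : 𝔥) : c.χ (c.χ x) + c.χc (c.χc x) = x :=
  DFunLike.congr_fun c.sum_sq x

theorem mem_Kχ_of_forall {S : 𝔥 →L[ℂ] 𝔥} (h : ∀ z, S (c.χ z) ∈ c.Kχ) {y : 𝔥}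
    (hy : y ∈ c.Kχ) : S y ∈ c.Kχ := by
  have hle : c.Kχ ≤ c.Kχ.comap (S : 𝔥 →ₗ[ℂ] 𝔥) := by
    refine Submodule.topologicalClosure_minimal _ ?_ (c.isClosed_Kχ.preimage S.continuous)
    rintro _ ⟨z, rfl⟩
    exact h z
  exact hle hy

theorem χc_mem_Kχ {x : 𝔥} (hx : x ∈ c.Kχ) : c.χc x ∈ c.Kχ :=
  c.mem_Kχ_of_forall (fun z => by rw [← c.χ_χc_apply]; exact c.χ_mem_Kχ _) hx

theorem χ_mem_Kχc {x : 𝔥} (hx : x ∈ c.Kχc) : c.χ x ∈ c.Kχc := by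
  have hle : c.Kχc ≤ c.Kχc.comap (c.χ : 𝔥 →ₗ[ℂ] 𝔥) := by
    refine Submodule.topologicalClosure_minimal _ ?_ (c.isClosed_Kχc.preimage c.χ.continuous)
    rintro _ ⟨z, rfl⟩
    change c.χ (c.χc z) ∈ c.Kχc
    rw [c.χ_χc_apply]
    exact c.χc_mem_Kχc _
  exact hle hx

theorem inner_χ_left (x y : 𝔥) : inner ℂ (c.χ x) y = inner ℂ x (c.χ y) :=
  c.χ_pos.isSymmetric x y

theorem eq_zero_of_mem_Kχ {x : 𝔥} (hx : x ∈ c.Kχ) (h : c.χ x = 0) : x = 0 := by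
  have hle : c.Kχ ≤ (ℂ ∙ x)ᗮ := by
    refine Submodule.topologicalClosure_minimal _ ?_ (Submodule.isClosed_orthogonal _)
    rintro _ ⟨z, rfl⟩
    rw [Submodule.mem_orthogonal_singleton_iff_inner_right]
    change inner ℂ x (c.χ z) = 0
    rw [← c.inner_χ_left, h, inner_zero_left]
  exact inner_self_eq_zero.mp (Submodule.mem_orthogonal_singleton_iff_inner_right.mp (hle hx))

theorem χ_Pχ (x : 𝔥) : c.χ (c.Pχ x) = c.χ x := by
  refine ext_inner_right ℂ fun y => ?_
  have hP : ∀ u v : 𝔥, inner ℂ (c.Pχ u) v = inner ℂ u (c.Pχ v) := c.Pχ_sa.isSymmetric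
  rw [c.inner_χ_left, c.inner_χ_left, hP, c.Pχ_fix _ (c.χ_mem_Kχ y)]

theorem mem_Kχc_of_χ_eq_zero {x : 𝔥} (h : c.χ x = 0) : x ∈ c.Kχc := by
  have hx := c.sum_sq_apply x
  rw [h, map_zero, zero_add] at hx
  rw [← hx]
  exact c.χc_mem_Kχc _

end ChiSetup

namespace HypT

variable {c : ChiSetup 𝔥} {D : Submodule ℂ 𝔥} {T : 𝔥 →ₗ[ℂ] 𝔥} {RT : 𝔥 →L[ℂ] 𝔥}

theorem inv_χ (hT : HypT c D T) (hRT : IsBddInvOn T D c.Kχc RT) {y : 𝔥} (hy : y ∈ c.Kχc) :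
    RT (c.χ y) = c.χ (RT y) := by
  obtain ⟨hD, hK, hTR⟩ := hRT.2.1 y hy
  have h := hRT.2.2 _ (hT.mapχ _ hD) (c.χ_mem_Kχc hK)
  rwa [← hT.commχ _ hD, hTR] at h

theorem inv_χc_mem_Kχ (hT : HypT c D T) (hRT : IsBddInvOn T D c.Kχc RT) {y : 𝔥}
    (hy : y ∈ c.Kχ) : RT (c.χc y) ∈ c.Kχ := by
  refine c.mem_Kχ_of_forall (S := RT ∘L c.χc) (fun z => ?_) hy
  change RT (c.χc (c.χ z)) ∈ c.Kχ
  rw [← c.χ_χc_apply, hT.inv_χ hRT (c.χc_mem_Kχc z)]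
  exact c.χ_mem_Kχ _

theorem inv_mem_Kχ (hT : HypT c D T) (hRT : IsBddInvOn T D c.Kχc RT) {y : 𝔥}
    (hy : y ∈ c.Kχ) (hyc : y ∈ c.Kχc) : RT y ∈ c.Kχ := by
  rw [← c.sum_sq_apply y, map_add, hT.inv_χ hRT (c.χ_mem_Kχc hyc)]
  exact add_mem (c.χ_mem_Kχ _) (hT.inv_χc_mem_Kχ hRT (c.χc_mem_Kχ hy))

/-- `T` leaves `𝔥_χ` invariant. -/
theorem apply_mem_Kχ (hT : HypT c D T) {x : 𝔥} (hxD : x ∈ D) (hx : x ∈ c.Kχ) :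
    T x ∈ c.Kχ := by
  obtain ⟨RT, hRT⟩ := hT.invχc
  have hbc : T (c.χc x) ∈ c.Kχc := by
    rw [← hT.commχc x hxD]
    exact c.χc_mem_Kχc _
  have hb : T (c.χc x) ∈ c.Kχ := by
    set b := T (c.χc x) with hb_def
    have hRb : RT b = c.χc x := hRT.2.2 _ (hT.mapχc x hxD) (c.χc_mem_Kχc x)
    have ha : c.χ (b - c.Pχ b) = 0 := by rw [map_sub, c.χ_Pχ, sub_self]
    have hac := c.mem_Kχc_of_χ_eq_zero ha
    have hPb : c.Pχ b ∈ c.Kχ := c.Pχ_mem b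
    have hPbc : c.Pχ b ∈ c.Kχc := by simpa using sub_mem hbc hac
    have hRa : RT (b - c.Pχ b) = 0 := by
      refine c.eq_zero_of_mem_Kχ ?_ ?_
      · rw [map_sub, hRb]
        exact sub_mem (c.χc_mem_Kχ hx) (hT.inv_mem_Kχ hRT hPb hPbc)
      · rw [← hT.inv_χ hRT hac, ha, map_zero]
    have h0 := (hRT.2.1 _ hac).2.2
    rw [hRa, map_zero] at h0
    rwa [sub_eq_zero.mp h0.symm]
  rw [← c.sum_sq_apply (T x), hT.commχc x hxD]
  exact add_mem (c.χ_mem_Kχ _) (c.χc_mem_Kχ hb)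

end HypT

/-- The operator `Q = χ − χ̄ H_{χ̄,T}⁻¹ χ̄ W_T χ`, where `R` plays the role of `H_{χ̄,T}⁻¹`. -/
def feshbachQ (c : ChiSetup 𝔥) (T H : 𝔥 →ₗ[ℂ] 𝔥) (R : 𝔥 →L[ℂ] 𝔥) : 𝔥 →ₗ[ℂ] 𝔥 :=
  (c.χ : 𝔥 →ₗ[ℂ] 𝔥) - (c.χc : 𝔥 →ₗ[ℂ] 𝔥) ∘ₗ (R : 𝔥 →ₗ[ℂ] 𝔥) ∘ₗ (c.χc : 𝔥 →ₗ[ℂ] 𝔥) ∘ₗ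
    (H - T) ∘ₗ (c.χ : 𝔥 →ₗ[ℂ] 𝔥)

/-- The operator `Q# = χ − χ W_T χ̄ H_{χ̄,T}⁻¹ χ̄`, where `R` plays the role of
`H_{χ̄,T}⁻¹`. -/
def feshbachQSharp (c : ChiSetup 𝔥) (T H : 𝔥 →ₗ[ℂ] 𝔥) (R : 𝔥 →L[ℂ] 𝔥) : 𝔥 →ₗ[ℂ] 𝔥 :=
  (c.χ : 𝔥 →ₗ[ℂ] 𝔥) - (c.χ : 𝔥 →ₗ[ℂ] 𝔥) ∘ₗ (H - T) ∘ₗ (c.χc : 𝔥 →ₗ[ℂ] 𝔥) ∘ₗ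
    (R : 𝔥 →ₗ[ℂ] 𝔥) ∘ₗ (c.χc : 𝔥 →ₗ[ℂ] 𝔥)

section Feshbach

variable {c : ChiSetup 𝔥} {D : Submodule ℂ 𝔥} {T H : 𝔥 →ₗ[ℂ] 𝔥} {R RT RH RF : 𝔥 →L[ℂ] 𝔥}

theorem Hbar_apply (x : 𝔥) : Hbar c T H x = T x + c.χc ((H - T) (c.χc x)) := rfl

theorem Fes_apply (x : 𝔥) : Fes c T H R x = T x + c.χ ((H - T) (c.χ x)) -
    c.χ ((H - T) (c.χc (R (c.χc ((H - T) (c.χ x)))))) := rfl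

theorem feshbachQ_apply (x : 𝔥) :
    feshbachQ c T H R x = c.χ x - c.χc (R (c.χc ((H - T) (c.χ x)))) := rfl

theorem feshbachQSharp_apply (y : 𝔥) :
    feshbachQSharp c T H R y = c.χ y - c.χ ((H - T) (c.χc (R (c.χc y)))) := rfl

theorem feshbachQSharp_mem (y : 𝔥) : feshbachQSharp c T H R y ∈ c.Kχ :=
  sub_mem (c.χ_mem_Kχ _) (c.χ_mem_Kχ _)

theorem χc_inv_mem (hT : HypT c D T) (hR : IsBddInvOn (Hbar c T H) D c.Kχc R) (y : 𝔥) :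
    c.χc (R (c.χc y)) ∈ D :=
  hT.mapχc _ (hR.2.1 _ (c.χc_mem_Kχc y)).1

theorem feshbachQ_mem (hT : HypT c D T) (hR : IsBddInvOn (Hbar c T H) D c.Kχc R) {x : 𝔥}
    (hx : x ∈ D) : feshbachQ c T H R x ∈ D :=
  sub_mem (hT.mapχ _ hx) (χc_inv_mem hT hR _)

theorem apply_χc_inv (hT : HypT c D T) (hR : IsBddInvOn (Hbar c T H) D c.Kχc R) (y : 𝔥) :
    H (c.χc (R (c.χc y))) =
      c.χc (c.χc y) + c.χ (c.χ ((H - T) (c.χc (R (c.χc y))))) := by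
  obtain ⟨hD, -, hinv⟩ := hR.2.1 _ (c.χc_mem_Kχc y)
  set u := R (c.χc y)
  rw [← hinv, Hbar_apply, map_add, hT.commχc u hD, add_assoc,
    add_comm (c.χc (c.χc _)), c.sum_sq_apply]
  simp

/-- `H Q = χ F_{χ,T}(H)` on the domain of `T`. -/
theorem apply_feshbachQ (hT : HypT c D T) (hR : IsBddInvOn (Hbar c T H) D c.Kχc R) {x : 𝔥}
    (hx : x ∈ D) : H (feshbachQ c T H R x) = c.χ (Fes c T H R x) := by
  have h := c.sum_sq_apply ((H - T) (c.χ x))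
  have hH : H (c.χ x) = c.χ (T x) + (H - T) (c.χ x) := by
    rw [hT.commχ x hx]
    simp
  rw [feshbachQ_apply, map_sub, apply_χc_inv hT hR, hH, Fes_apply, map_sub, map_add]
  nth_rewrite 1 [← h]
  abel

theorem inv_χc_apply (hT : HypT c D T) (hR : IsBddInvOn (Hbar c T H) D c.Kχc R) {x : 𝔥}
    (hx : x ∈ D) :
    R (c.χc (H x)) = c.χc x + R (c.χc ((H - T) (c.χ (c.χ x)))) := by
  have hinv := hR.2.2 _ (hT.mapχc x hx) (c.χc_mem_Kχc x)
  have h : c.χc (H x) =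
      Hbar c T H (c.χc x) + c.χc ((H - T) (c.χ (c.χ x))) := by
    have hW : (H - T) x = (H - T) (c.χ (c.χ x)) + (H - T) (c.χc (c.χc x)) := by
      rw [← map_add, c.sum_sq_apply]
    have hHx : H x = T x + (H - T) x := by simp
    rw [hHx, hW, Hbar_apply, map_add, map_add, hT.commχc x hx]
    abel
  rw [h, map_add, hinv]

/-- `Q χ = 1 − χ̄ H_{χ̄,T}⁻¹ χ̄ H` on the domain of `T`. -/
theorem feshbachQ_χ (hT : HypT c D T) (hR : IsBddInvOn (Hbar c T H) D c.Kχc R) {x : 𝔥}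
    (hx : x ∈ D) : feshbachQ c T H R (c.χ x) = x - c.χc (R (c.χc (H x))) := by
  rw [feshbachQ_apply, inv_χc_apply hT hR hx, map_add]
  linear_combination (norm := abel) c.sum_sq_apply x

/-- `F_{χ,T}(H) χ = Q# H` on the domain of `T`. -/
theorem Fes_χ (hT : HypT c D T) (hR : IsBddInvOn (Hbar c T H) D c.Kχc R) {x : 𝔥}
    (hx : x ∈ D) : Fes c T H R (c.χ x) = feshbachQSharp c T H R (H x) := by
  have hW : (H - T) x = (H - T) (c.χ (c.χ x)) + (H - T) (c.χc (c.χc x)) := by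
    rw [← map_add, c.sum_sq_apply]
  have hHx : c.χ (H x) = T (c.χ x) + c.χ ((H - T) (c.χ (c.χ x))) +
      c.χ ((H - T) (c.χc (c.χc x))) := by
    rw [← hT.commχ x hx, add_assoc, ← map_add, ← hW, ← map_add]
    simp
  rw [feshbachQSharp_apply, inv_χc_apply hT hR hx, hHx, Fes_apply]
  simp only [map_add]
  abel

/-- `χ Q = 1 − χ̄ T_χ̄⁻¹ χ̄ F_{χ,T}(H)` on the domain of `T`. -/
theorem χ_feshbachQ (hT : HypT c D T) (hR : IsBddInvOn (Hbar c T H) D c.Kχc R)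
    (hRT : IsBddInvOn T D c.Kχc RT) {x : 𝔥} (hx : x ∈ D) :
    c.χ (feshbachQ c T H R x) = x - c.χc (RT (c.χc (Fes c T H R x))) := by
  obtain ⟨hD, hK, hinv⟩ := hR.2.1 _ (c.χc_mem_Kχc ((H - T) (c.χ x)))
  rw [feshbachQ_apply, Fes_apply]
  set u := R (c.χc ((H - T) (c.χ x)))
  have hF : c.χc (T x + c.χ ((H - T) (c.χ x)) - c.χ ((H - T) (c.χc u))) =
      T (c.χc x + c.χ u) := by
    rw [map_sub, map_add, ← c.χ_χc_apply, ← c.χ_χc_apply, ← hinv, Hbar_apply, map_add, map_add,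
      hT.commχ u hD, hT.commχc x hx]
    abel
  rw [hF, hRT.2.2 _ (add_mem (hT.mapχc x hx) (hT.mapχ u hD))
    (add_mem (c.χc_mem_Kχc x) (c.χ_mem_Kχc hK)), map_sub, map_add, c.χ_χc_apply]
  nth_rewrite 2 [← c.sum_sq_apply x]
  abel

theorem Fes_χc_inv (hT : HypT c D T) (hR : IsBddInvOn (Hbar c T H) D c.Kχc R)
    (hRT : IsBddInvOn T D c.Kχc RT) (y : 𝔥) :
    Fes c T H R (c.χc (RT (c.χc y))) = y - feshbachQSharp c T H R (c.χ y) := by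
  obtain ⟨hD, hK, hinv⟩ := hRT.2.1 _ (c.χc_mem_Kχc y)
  rw [feshbachQSharp_apply, Fes_apply]
  set w := RT (c.χc y)
  have hHbar : c.χc ((H - T) (c.χc (c.χ w))) = Hbar c T H (c.χ w) - c.χc (c.χ y) := by
    rw [Hbar_apply, ← hT.commχ w hD, hinv, c.χ_χc_apply]
    abel
  rw [← hT.commχc w hD, hinv, c.χ_χc_apply w, hHbar, map_sub,
    hR.2.2 _ (hT.mapχ w hD) (c.χ_mem_Kχc hK)]
  simp only [map_sub]
  linear_combination (norm := abel) c.sum_sq_apply y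

theorem Fes_mem_Kχ (hT : HypT c D T) {x : 𝔥} (hxD : x ∈ D) (hx : x ∈ c.Kχ) :
    Fes c T H R x ∈ c.Kχ :=
  sub_mem (add_mem (hT.apply_mem_Kχ hxD hx) (c.χ_mem_Kχ _)) (c.χ_mem_Kχ _)

/-- If `H` is bounded invertible, then `χ H⁻¹ χ + χ̄ T_χ̄⁻¹ χ̄` inverts `F_{χ,T}(H)`. -/
theorem isBddInvOn_Fes (hT : HypT c D T) (hR : IsBddInvOn (Hbar c T H) D c.Kχc R)
    (hRT : IsBddInvOn T D c.Kχc RT) (hRH : IsBddInvOn H D ⊤ RH) :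
    IsBddInvOn (Fes c T H R) D c.Kχ (c.χ ∘L RH ∘L c.χ + c.χc ∘L RT ∘L c.χc) := by
  refine ⟨fun x hxD hx => Fes_mem_Kχ hT hxD hx, fun y hy => ?_, fun x hxD _ => ?_⟩
  · obtain ⟨hD, -, hinv⟩ := hRH.2.1 (c.χ y) trivial
    refine ⟨add_mem (hT.mapχ _ hD) (hT.mapχc _ (hRT.2.1 _ (c.χc_mem_Kχc y)).1),
      add_mem (c.χ_mem_Kχ _) (c.χc_mem_Kχ (hT.inv_χc_mem_Kχ hRT hy)), ?_⟩
    change Fes c T H R (c.χ (RH (c.χ y)) + c.χc (RT (c.χc y))) = y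
    rw [map_add, Fes_χ hT hR hD, hinv, Fes_χc_inv hT hR hRT]
    abel
  · change c.χ (RH (c.χ (Fes c T H R x))) + c.χc (RT (c.χc (Fes c T H R x))) = x
    rw [← apply_feshbachQ hT hR hxD, hRH.2.2 _ (feshbachQ_mem hT hR hxD) trivial,
      χ_feshbachQ hT hR hRT hxD]
    abel

/-- An algebraic two-sided inverse of a closed operator is bounded. -/
theorem bddInvOn_top_of_linear_inverse
    (hH : IsClosed {p : 𝔥 × 𝔥 | p.1 ∈ D ∧ H p.1 = p.2}) (S : 𝔥 →ₗ[ℂ] 𝔥)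
    (hS : ∀ y, S y ∈ D ∧ H (S y) = y) (hSH : ∀ x ∈ D, S (H x) = x) : BddInvOn H D ⊤ := by
  have hgraph : IsClosed (S.graph : Set (𝔥 × 𝔥)) := by
    have heq : (S.graph : Set (𝔥 × 𝔥)) =
        Prod.swap ⁻¹' {p : 𝔥 × 𝔥 | p.1 ∈ D ∧ H p.1 = p.2} := by
      ext ⟨y, x⟩
      simp only [SetLike.mem_coe, LinearMap.mem_graph_iff, Set.mem_preimage, Prod.swap_prod_mk,
        Set.mem_ofPred_eq]
      constructor
      · rintro rfl
        exact hS y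
      · rintro ⟨hx, rfl⟩
        exact (hSH x hx).symm
    rw [heq]
    exact hH.preimage continuous_swap
  exact ⟨⟨S, S.continuous_of_isClosed_graph hgraph⟩, fun _ _ _ => trivial,
    fun y _ => ⟨(hS y).1, trivial, (hS y).2⟩, fun x hx _ => hSH x hx⟩

/-- If `F_{χ,T}(H)` is bounded invertible, then so is `H`, with inverse
`Q F_{χ,T}(H)⁻¹ Q# + χ̄ H_{χ̄,T}⁻¹ χ̄`. -/
theorem bddInvOn_of_Fes (hT : HypT c D T)
    (hH : IsClosed {p : 𝔥 × 𝔥 | p.1 ∈ D ∧ H p.1 = p.2})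
    (hR : IsBddInvOn (Hbar c T H) D c.Kχc R) (hRF : IsBddInvOn (Fes c T H R) D c.Kχ RF) :
    BddInvOn H D ⊤ := by
  refine bddInvOn_top_of_linear_inverse hH
    (feshbachQ c T H R ∘ₗ (RF : 𝔥 →ₗ[ℂ] 𝔥) ∘ₗ feshbachQSharp c T H R +
      (c.χc ∘L R ∘L c.χc : 𝔥 →L[ℂ] 𝔥)) (fun y => ?_) (fun x hx => ?_)
  · obtain ⟨hD, -, hinv⟩ := hRF.2.1 _ (feshbachQSharp_mem (T := T) (H := H) (R := R) y)
    refine ⟨add_mem (feshbachQ_mem hT hR hD) (χc_inv_mem hT hR y), ?_⟩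
    change H (feshbachQ c T H R (RF (feshbachQSharp c T H R y)) + c.χc (R (c.χc y))) = y
    rw [map_add, apply_feshbachQ hT hR hD, hinv, apply_χc_inv hT hR, feshbachQSharp_apply,
      map_sub]
    linear_combination (norm := abel) c.sum_sq_apply y
  · change feshbachQ c T H R (RF (feshbachQSharp c T H R (H x))) + c.χc (R (c.χc (H x))) = x
    rw [← Fes_χ hT hR hx, hRF.2.2 _ (hT.mapχ x hx) (c.χ_mem_Kχ x), feshbachQ_χ hT hR hx]
    abel

/-- `χ` restricts to an isomorphism from the kernel of `H` onto the kernel of `F_{χ,T}(H)`,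
with inverse `Q`; in particular the kernels have the same dimension. -/
theorem rank_ker_eq_rank_ker_Fes (hT : HypT c D T)
    (hR : IsBddInvOn (Hbar c T H) D c.Kχc R) :
    Module.rank ℂ ↥(LinearMap.ker H ⊓ D) =
      Module.rank ℂ ↥(LinearMap.ker (Fes c T H R) ⊓ (D ⊓ c.Kχ)) := by
  have hχ : ∀ x ∈ LinearMap.ker H ⊓ D,
      (c.χ : 𝔥 →ₗ[ℂ] 𝔥) x ∈ LinearMap.ker (Fes c T H R) ⊓ (D ⊓ c.Kχ) := fun x hx =>
    ⟨by
      change Fes c T H R (c.χ x) = 0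
      rw [Fes_χ hT hR hx.2, LinearMap.mem_ker.mp hx.1, map_zero],
      hT.mapχ x hx.2, c.χ_mem_Kχ x⟩
  have hQ : ∀ x ∈ LinearMap.ker (Fes c T H R) ⊓ (D ⊓ c.Kχ),
      feshbachQ c T H R x ∈ LinearMap.ker H ⊓ D := fun x hx =>
    ⟨by
      change H (feshbachQ c T H R x) = 0
      rw [apply_feshbachQ hT hR hx.2.1, LinearMap.mem_ker.mp hx.1, map_zero],
      feshbachQ_mem hT hR hx.2.1⟩
  refine (LinearEquiv.ofLinearMap ((c.χ : 𝔥 →ₗ[ℂ] 𝔥).restrict hχ)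
    ((feshbachQ c T H R).restrict hQ) ?_ ?_).rank_eq
  · ext ⟨x, hx⟩
    obtain ⟨RT, hRT⟩ := hT.invχc
    change c.χ (feshbachQ c T H R x) = x
    rw [χ_feshbachQ hT hR hRT hx.2.1, LinearMap.mem_ker.mp hx.1]
    simp
  · ext ⟨x, hx⟩
    change feshbachQ c T H R (c.χ x) = x
    rw [feshbachQ_χ hT hR hx.2, LinearMap.mem_ker.mp hx.1]
    simp

end Feshbach

/-- isospectrality: if `H` is in the domain of `F_{χ,T}`, then `H` is
bounded invertible on `𝔥` iff `F_{χ,T}(H) : 𝔇_χ → 𝔥_χ` is bounded invertible on `𝔥_χ`;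
in either case `F_{χ,T}(H)⁻¹ = [χ H⁻¹ χ + χ̄ T_χ̄⁻¹ χ̄]|_{𝔥_χ}`, and the kernels of `H`
and of `F_{χ,T}(H)` have the same dimension. -/
theorem smooth_feshbach_isospectral
    (c : ChiSetup 𝔥) (D : Submodule ℂ 𝔥) (T H : 𝔥 →ₗ[ℂ] 𝔥)
    (hT : HypT c D T)
    (hHclosed : IsClosed {p : 𝔥 × 𝔥 | p.1 ∈ D ∧ H p.1 = p.2})
    (hH : MemDomF c D T H) :
    ∀ R : 𝔥 →L[ℂ] 𝔥, IsBddInvOn (Hbar c T H) D c.Kχc R →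
      (BddInvOn H D ⊤ ↔ BddInvOn (Fes c T H R) D c.Kχ) ∧
      (∀ RH RT RF : 𝔥 →L[ℂ] 𝔥,
        IsBddInvOn H D ⊤ RH →
        IsBddInvOn T D c.Kχc RT →
        IsBddInvOn (Fes c T H R) D c.Kχ RF →
        ∀ y ∈ c.Kχ, RF y = c.χ (RH (c.χ y)) + c.χc (RT (c.χc y))) ∧
      Module.rank ℂ ↥(LinearMap.ker H ⊓ D) =
        Module.rank ℂ ↥(LinearMap.ker (Fes c T H R) ⊓ (D ⊓ c.Kχ)) := by
  intro R hR
  refine ⟨⟨?_, fun ⟨RF, hRF⟩ => bddInvOn_of_Fes hT hHclosed hR hRF⟩,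
    fun RH RT RF hRH hRT hRF y hy => ?_, rank_ker_eq_rank_ker_Fes hT hR⟩
  · rintro ⟨RH, hRH⟩
    obtain ⟨RT, hRT⟩ := hT.invχc
    exact ⟨_, isBddInvOn_Fes hT hR hRT hRH⟩
  · obtain ⟨hD, hK, hinv⟩ := (isBddInvOn_Fes hT hR hRT hRH).2.1 y hy
    have h := hRF.2.2 _ hD hK
    rwa [hinv] at h

end
end

section
/- Under the bounded commuting setup, the quadratic term of the smooth Feshbach–Schur map satisfies: χ W_T χ̄ (H_{χ̄,T})^{-1} χ̄ W_T χ − χ f_{χ,T}(S) W_S χ̄ (H_{χ̄,T})^{-1} χ̄ W_S f_{χ,T}(S) χ = χ f_{χ,T}(S) W_S (1 − f_{χ,T}(S)) χ + χ (1 − f_{χ,T}(S)) W_T χ, as bounded operators on 𝔥. -/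
open ContinuousLinearMap

noncomputable section

variable {𝔥 : Type*} [NormedAddCommGroup 𝔥] [InnerProductSpace ℂ 𝔥] [CompleteSpace 𝔥]

/-- `R` is a two-sided inverse, on the closed subspace `K`, of the restriction to `K`
of the bounded operator `A` (which maps `K` into itself); this encodes that `A|_K` is
bounded invertible on `K` with inverse `R|_K`. -/
def IsInvK (A R : 𝔥 →L[ℂ] 𝔥) (K : Submodule ℂ 𝔥) : Prop :=
  (∀ x ∈ K, A x ∈ K) ∧ ∀ y ∈ K, R y ∈ K ∧ A (R y) = y ∧ R (A y) = y

/-- The bounded commuting setup: `χ, χ̄` are bounded, self-adjoint, positive operators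
with `χ² + χ̄² = 1`; `H, T, S` are bounded operators such that `T, S, χ, χ̄` mutually
commute; `Pχc` is the orthogonal projection onto `𝔥_χ̄ = closure (Ran χ̄)`;
`T|_{𝔥_χ̄}` and `S|_{𝔥_χ̄}` are bounded invertible on `𝔥_χ̄` (with inverses `RT`, `RS`);
`H_{χ̄,T} = T + χ̄(H − T)χ̄` is bounded invertible on `𝔥_χ̄` (with inverse `RH`), so `H`
lies in the domain of `F_{χ,T}`; and `Δ_{χ,T}(S) = Tχ² + Sχ̄²` restricted to `𝔥_χ̄` is
bounded invertible (with inverse `RΔ`). -/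
structure BddSetup (𝔥 : Type*) [NormedAddCommGroup 𝔥] [InnerProductSpace ℂ 𝔥]
    [CompleteSpace 𝔥] where
  χ : 𝔥 →L[ℂ] 𝔥
  χc : 𝔥 →L[ℂ] 𝔥
  Pχc : 𝔥 →L[ℂ] 𝔥
  H : 𝔥 →L[ℂ] 𝔥
  T : 𝔥 →L[ℂ] 𝔥
  S : 𝔥 →L[ℂ] 𝔥
  RT : 𝔥 →L[ℂ] 𝔥
  RS : 𝔥 →L[ℂ] 𝔥
  RH : 𝔥 →L[ℂ] 𝔥
  RΔ : 𝔥 →L[ℂ] 𝔥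
  χ_pos : χ.IsPositive
  χc_pos : χc.IsPositive
  sum_sq : χ ∘L χ + χc ∘L χc = 1
  comm_χχc : χ ∘L χc = χc ∘L χ
  comm_TS : T ∘L S = S ∘L T
  comm_Tχ : T ∘L χ = χ ∘L T
  comm_Tχc : T ∘L χc = χc ∘L T
  comm_Sχ : S ∘L χ = χ ∘L S
  comm_Sχc : S ∘L χc = χc ∘L S
  Pχc_sa : IsSelfAdjoint Pχc
  Pχc_idem : Pχc ∘L Pχc = Pχc
  Pχc_mem : ∀ x : 𝔥, Pχc x ∈ (LinearMap.range (χc : 𝔥 →ₗ[ℂ] 𝔥)).topologicalClosure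
  Pχc_fix : ∀ x ∈ (LinearMap.range (χc : 𝔥 →ₗ[ℂ] 𝔥)).topologicalClosure, Pχc x = x
  invT : IsInvK T RT (LinearMap.range (χc : 𝔥 →ₗ[ℂ] 𝔥)).topologicalClosure
  invS : IsInvK S RS (LinearMap.range (χc : 𝔥 →ₗ[ℂ] 𝔥)).topologicalClosure
  invH : IsInvK (T + χc ∘L (H - T) ∘L χc) RH
    (LinearMap.range (χc : 𝔥 →ₗ[ℂ] 𝔥)).topologicalClosure
  invΔ : IsInvK (T ∘L χ ∘L χ + S ∘L χc ∘L χc) RΔ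
    (LinearMap.range (χc : 𝔥 →ₗ[ℂ] 𝔥)).topologicalClosure

namespace BddSetup

variable {𝔥 : Type*} [NormedAddCommGroup 𝔥] [InnerProductSpace ℂ 𝔥] [CompleteSpace 𝔥]
variable (c : BddSetup 𝔥)

/-- `𝔥_χ`, the closure of the range of `χ`. -/
def Kχ : Submodule ℂ 𝔥 := (LinearMap.range (c.χ : 𝔥 →ₗ[ℂ] 𝔥)).topologicalClosure

/-- `𝔥_χ̄`, the closure of the range of `χ̄`. -/
def Kχc : Submodule ℂ 𝔥 := (LinearMap.range (c.χc : 𝔥 →ₗ[ℂ] 𝔥)).topologicalClosure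

/-- `W_T := H − T`. -/
def WT : 𝔥 →L[ℂ] 𝔥 := c.H - c.T

/-- `W_S := H − S`. -/
def WS : 𝔥 →L[ℂ] 𝔥 := c.H - c.S

/-- `H_{χ̄,T} := T + χ̄ W_T χ̄` (whose restriction to `𝔥_χ̄` is the relevant operator). -/
def HbarT : 𝔥 →L[ℂ] 𝔥 := c.T + c.χc ∘L (c.H - c.T) ∘L c.χc

/-- `Δ_{χ,T}(S) := Tχ² + Sχ̄²`. -/
def Delta : 𝔥 →L[ℂ] 𝔥 := c.T ∘L c.χ ∘L c.χ + c.S ∘L c.χc ∘L c.χc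

/-- `f_{χ,T}(S) := (T (Δ_{χ,T}(S)|_{𝔥_χ̄})⁻¹) ⊕ 1` with respect to `𝔥 = 𝔥_χ̄ ⊕ 𝔥_χ̄^⊥`. -/
def f : 𝔥 →L[ℂ] 𝔥 := c.T ∘L c.RΔ ∘L c.Pχc + (1 - c.Pχc)

/-- The smooth Feshbach–Schur map
`F_{χ,T}(H) = T + χ W_T χ − χ W_T χ̄ (H_{χ̄,T})⁻¹ χ̄ W_T χ` (on `𝔥_χ`). -/
def Fes : 𝔥 →L[ℂ] 𝔥 :=
  c.T + c.χ ∘L c.WT ∘L c.χ - c.χ ∘L c.WT ∘L c.χc ∘L c.RH ∘L c.χc ∘L c.WT ∘L c.χ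

end BddSetup

/-- The algebraic core of the identity, in an arbitrary ring: `x`, `t`, `e`, `d`, `r` stand for
`χ̄`, `T`, `S - T`, `Δ⁻¹`, `(H_{χ̄,T})⁻¹` and `v` for `W_T`, so that `v - e` is `W_S`. -/
theorem quadratic_term_ring {R : Type*} [Ring R] {x t e d r v f : R}
    (hxt : Commute x t) (hxe : Commute x e) (hxd : Commute x d) (hte : Commute t e)
    (htd : Commute t d) (hed : Commute e d) (hf : 1 - f = x * x * e * d)
    (hxf : x * f = t * d * x) (hr : (t + x * v * x) * r * x = x)
    (hr' : r * (t + x * v * x) * x = x) :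
    v * x * r * x * v - f * (v - e) * x * r * x * (v - e) * f
      = f * (v - e) * (1 - f) + (1 - f) * v := by
  have hf' : f = 1 - x * x * e * d := by rw [← hf]; abel
  have hfe : 1 - f = x * e * d * x := by
    rw [hf, mul_assoc (x * e), ← hxd.eq, ← mul_assoc, mul_assoc x e x, ← hxe.eq, ← mul_assoc]
  have hxted : x * e * f = t * x * e * d := by
    calc x * e * f = e * (x * f) := by rw [hxe.eq, mul_assoc]
      _ = e * t * d * x := by rw [hxf]; noncomm_ring
      _ = t * x * e * d := by
        rw [← hte.eq, mul_assoc _ d x, ← hxd.eq, ← mul_assoc, mul_assoc t e x, ← hxe.eq]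
        noncomm_ring
  have hfex : f * e * x = x * e * d * t := by
    have hfx : Commute x f := by
      rw [hf']
      exact (Commute.one_right x).sub_right
        ((((Commute.refl x).mul_right (Commute.refl x)).mul_right hxe).mul_right hxd)
    have hfe' : Commute e f := by
      rw [hf']
      exact (Commute.one_right e).sub_right
        (((hxe.symm.mul_right hxe.symm).mul_right (Commute.refl e)).mul_right hed)
    have htxed : Commute t (x * e * d) := (hxt.symm.mul_right hte).mul_right htd
    rw [← htxed.eq, ← mul_assoc, ← mul_assoc, ← hxted, mul_assoc f, ← hxe.eq]
    exact ((hfx.mul_left hfe').eq).symm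
  have hright : x * (v - e) * f = x * v - (t + x * v * x) * (x * e * d) := by
    calc x * (v - e) * f = x * v * f - x * e * f := by noncomm_ring
      _ = _ := by rw [hxted, hf']; noncomm_ring
  have hleft : f * (v - e) * x = v * x - x * e * d * (t + x * v * x) := by
    have hf'' : f = 1 - x * e * d * x := by rw [← hfe]; abel
    calc f * (v - e) * x = f * v * x - f * e * x := by noncomm_ring
      _ = _ := by rw [hfex, hf'']; noncomm_ring
  have hmid : r * (x * (v - e) * f) = r * x * v - x * e * d := by
    calc r * (x * (v - e) * f) = r * x * v - r * (t + x * v * x) * x * (e * d) := by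
          rw [hright]; noncomm_ring
      _ = _ := by rw [hr', mul_assoc x e d]
  have hmain : f * (v - e) * x * r * x * (v - e) * f
      = v * x * r * x * v - (1 - f) * v - f * (v - e) * (1 - f) := by
    calc f * (v - e) * x * r * x * (v - e) * f
        = f * (v - e) * x * (r * (x * (v - e) * f)) := by noncomm_ring
      _ = f * (v - e) * x * (r * x * v) - f * (v - e) * (x * x * e * d) := by
        rw [hmid]; noncomm_ring
      _ = v * x * r * x * v - x * e * d * ((t + x * v * x) * r * x) * v
          - f * (v - e) * (1 - f) := by
        rw [hleft, hf]; noncomm_ring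
      _ = _ := by rw [hr, ← hfe]
  rw [hmain]
  abel

namespace BddSetup

section

variable {𝔥 : Type*} [NormedAddCommGroup 𝔥] [InnerProductSpace ℂ 𝔥] [CompleteSpace 𝔥]
variable (c : BddSetup 𝔥)

theorem χc_mem_Kχc (y : 𝔥) : c.χc y ∈ c.Kχc :=
  Submodule.le_topologicalClosure _ ⟨y, rfl⟩

theorem Pχc_mul_χc : c.Pχc * c.χc = c.χc :=
  ContinuousLinearMap.ext fun y => c.Pχc_fix _ (c.χc_mem_Kχc y)

theorem χc_mul_Pχc : c.χc * c.Pχc = c.χc := by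
  have h := congrArg star c.Pχc_mul_χc
  rwa [star_mul, c.χc_pos.isSelfAdjoint.star_eq, c.Pχc_sa.star_eq] at h

theorem Pχc_apply_eq_zero {y : 𝔥} (hy : c.χc y = 0) : c.Pχc y = 0 := by
  have hsymm (u w : 𝔥) (A : 𝔥 →L[ℂ] 𝔥) (hA : IsSelfAdjoint A) :
      inner ℂ (A u) w = inner ℂ u (A w) := by
    rw [← ContinuousLinearMap.adjoint_inner_left, hA.adjoint_eq]
  have hperp : y ∈ (c.Kχc)ᗮ := by
    rw [Kχc, Submodule.orthogonal_closure, Submodule.mem_orthogonal]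
    rintro _ ⟨u, rfl⟩
    change inner ℂ (c.χc u) y = 0
    rw [hsymm u y c.χc c.χc_pos.isSelfAdjoint, hy, inner_zero_right]
  have hPP : c.Pχc (c.Pχc y) = c.Pχc y := congrArg (fun A : 𝔥 →L[ℂ] 𝔥 => A y) c.Pχc_idem
  rw [← inner_self_eq_zero (𝕜 := ℂ), hsymm _ _ _ c.Pχc_sa, hPP]
  exact Submodule.inner_left_of_mem_orthogonal (c.Pχc_mem y) hperp

variable {c}

theorem apply_mem_Kχc {A : 𝔥 →L[ℂ] 𝔥} (hA : Commute A c.χc) {y : 𝔥} (hy : y ∈ c.Kχc) :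
    A y ∈ c.Kχc := by
  refine map_mem_closure A.continuous hy ?_
  rintro _ ⟨u, rfl⟩
  exact ⟨A u, (congrArg (fun B : 𝔥 →L[ℂ] 𝔥 => B u) hA.eq).symm⟩

theorem commute_Pχc {A : 𝔥 →L[ℂ] 𝔥} (hA : Commute A c.χc) : Commute A c.Pχc := by
  refine ContinuousLinearMap.ext fun y => ?_
  have hz : c.χc (A (y - c.Pχc y)) = 0 := by
    have h : c.χc * A * (1 - c.Pχc) = 0 := by
      rw [← hA.eq, mul_assoc, mul_sub, mul_one, χc_mul_Pχc, sub_self, mul_zero]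
    exact congrArg (fun B : 𝔥 →L[ℂ] 𝔥 => B y) h
  have h := c.Pχc_apply_eq_zero hz
  rw [map_sub, map_sub, sub_eq_zero, c.Pχc_fix _ (apply_mem_Kχc hA (c.Pχc_mem y))] at h
  exact h.symm

variable (c)

theorem Delta_mul_RΔ_mul_Pχc : c.Delta * (c.RΔ * c.Pχc) = c.Pχc :=
  ContinuousLinearMap.ext fun y => (c.invΔ.2 _ (c.Pχc_mem y)).2.1

variable {c}

theorem commute_RΔ_mul_Pχc {A : 𝔥 →L[ℂ] 𝔥} (hA : Commute A c.χc) (hΔ : Commute A c.Delta) :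
    Commute A (c.RΔ * c.Pχc) := by
  refine ContinuousLinearMap.ext fun y => ?_
  have hR := c.invΔ.2 _ (c.Pχc_mem y)
  have hAR := (c.invΔ.2 _ (apply_mem_Kχc hA hR.1)).2.2
  have hAΔ : A (c.Delta (c.RΔ (c.Pχc y))) = c.Delta (A (c.RΔ (c.Pχc y))) :=
    congrArg (fun B : 𝔥 →L[ℂ] 𝔥 => B (c.RΔ (c.Pχc y))) hΔ.eq
  have hAP : A (c.Pχc y) = c.Pχc (A y) :=
    congrArg (fun B : 𝔥 →L[ℂ] 𝔥 => B y) (commute_Pχc hA).eq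
  change A (c.RΔ (c.Pχc y)) = c.RΔ (c.Pχc (A y))
  rw [← hAP]
  refine hAR.symm.trans (congrArg c.RΔ ?_)
  exact hAΔ.symm.trans (congrArg A hR.2.1)

end

end BddSetup

/-- the quadratic term of the smooth Feshbach–Schur map satisfies
`χ W_T χ̄ (H_{χ̄,T})⁻¹ χ̄ W_T χ − χ f W_S χ̄ (H_{χ̄,T})⁻¹ χ̄ W_S f χ
  = χ f W_S (1 − f) χ + χ (1 − f) W_T χ`
as bounded operators on `𝔥`, where `f = f_{χ,T}(S)`. -/
theorem quadratic_term_identity (c : BddSetup 𝔥) :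
    c.χ ∘L c.WT ∘L c.χc ∘L c.RH ∘L c.χc ∘L c.WT ∘L c.χ
      - c.χ ∘L c.f ∘L c.WS ∘L c.χc ∘L c.RH ∘L c.χc ∘L c.WS ∘L c.f ∘L c.χ
      = c.χ ∘L c.f ∘L c.WS ∘L (1 - c.f) ∘L c.χ + c.χ ∘L (1 - c.f) ∘L c.WT ∘L c.χ := by
  have hχ : Commute c.χ c.χc := c.comm_χχc
  have hTS : Commute c.T c.S := c.comm_TS
  have hTχ : Commute c.T c.χ := c.comm_Tχ
  have hT : Commute c.T c.χc := c.comm_Tχc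
  have hSχ : Commute c.S c.χ := c.comm_Sχ
  have hS : Commute c.S c.χc := c.comm_Sχc
  have hsum : c.χ * c.χ = 1 - c.χc * c.χc := eq_sub_of_add_eq c.sum_sq
  have hDelta : c.Delta = c.T * (c.χ * c.χ) + c.S * (c.χc * c.χc) := rfl
  have hcomm {A : 𝔥 →L[ℂ] 𝔥} (h₁ : Commute A c.T) (h₂ : Commute A c.S) (h₃ : Commute A c.χ)
      (h₄ : Commute A c.χc) : Commute A (c.RΔ * c.Pχc) := by
    refine BddSetup.commute_RΔ_mul_Pχc h₄ ?_
    rw [hDelta]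
    exact (h₁.mul_right (h₃.mul_right h₃)).add_right (h₂.mul_right (h₄.mul_right h₄))
  have hTD := hcomm (Commute.refl _) hTS hTχ hT
  have hSD := hcomm hTS.symm (Commute.refl _) hSχ hS
  have hχcD := hcomm hT.symm hS.symm hχ.symm (Commute.refl _)
  have hfdef : c.f = c.T * (c.RΔ * c.Pχc) + (1 - c.Pχc) := rfl
  have hf : 1 - c.f = c.χc * c.χc * (c.S - c.T) * (c.RΔ * c.Pχc) := by
    have hΔ : c.Delta = c.T + c.χc * c.χc * (c.S - c.T) := by
      have h : Commute (c.S - c.T) (c.χc * c.χc) :=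
        (hS.sub_left hT).mul_right (hS.sub_left hT)
      rw [hDelta, hsum, ← h.eq]
      noncomm_ring
    have h := c.Delta_mul_RΔ_mul_Pχc
    rw [hΔ, add_mul] at h
    rw [hfdef, eq_sub_of_add_eq' h]
    abel
  have hχcf : c.χc * c.f = c.T * (c.RΔ * c.Pχc) * c.χc := by
    rw [hfdef, mul_add, mul_sub, mul_one, c.χc_mul_Pχc, sub_self, add_zero]
    exact (hT.symm.mul_right hχcD).eq
  have hr : (c.T + c.χc * c.WT * c.χc) * c.RH * c.χc = c.χc :=
    ContinuousLinearMap.ext fun y => (c.invH.2 _ (c.χc_mem_Kχc y)).2.1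
  have hr' : c.RH * (c.T + c.χc * c.WT * c.χc) * c.χc = c.χc :=
    ContinuousLinearMap.ext fun y => (c.invH.2 _ (c.χc_mem_Kχc y)).2.2
  have key := quadratic_term_ring hT.symm (hS.symm.sub_right hT.symm) hχcD
    (hTS.sub_right (Commute.refl _)) hTD (hSD.sub_left hTD) hf hχcf hr hr'
  have hWS : c.WT - (c.S - c.T) = c.WS := by
    rw [BddSetup.WT, BddSetup.WS]; abel
  rw [hWS] at key
  have hχkey := congrArg (fun A => c.χ * A * c.χ) key
  simp only [mul_sub, sub_mul, mul_add, add_mul, mul_one, one_mul, mul_assoc] at hχkey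
  simp only [← ContinuousLinearMap.mul_def, mul_sub, sub_mul, one_mul]
  exact hχkey

end
end

section
/- Under the bounded commuting setup, the free part of the smooth Feshbach–Schur map transforms as follows: the restriction to 𝔥_χ of T − χ f_{χ,T}(S) W_S χ + χ f_{χ,T}(S) W_T χ equals the restriction to 𝔥_χ of S·f_{χ,T}(S), as operators on 𝔥_χ. -/
open ContinuousLinearMap

noncomputable section

variable {𝔥 : Type*} [NormedAddCommGroup 𝔥] [InnerProductSpace ℂ 𝔥] [CompleteSpace 𝔥]

/-- `R` commutes on `K` with every operator that preserves `K` and commutes with `A`. -/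
theorem IsInvK.apply_comm {A R B : 𝔥 →L[ℂ] 𝔥} {K : Submodule ℂ 𝔥} (h : IsInvK A R K)
    (hB : ∀ x ∈ K, B x ∈ K) (hAB : ∀ x, A (B x) = B (A x)) {y : 𝔥} (hy : y ∈ K) :
    R (B y) = B (R y) := by
  obtain ⟨hRy, hARy, -⟩ := h.2 y hy
  have key := (h.2 _ (hB _ hRy)).2.2
  rwa [hAB, hARy] at key

namespace BddSetup

variable (c : BddSetup 𝔥)

theorem map_mem_Kχc {A : 𝔥 →L[ℂ] 𝔥} (hA : ∀ x, A (c.χc x) = c.χc (A x)) {x : 𝔥}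
    (hx : x ∈ c.Kχc) : A x ∈ c.Kχc := by
  refine map_mem_closure A.continuous hx ?_
  rintro _ ⟨y, rfl⟩
  exact ⟨A y, (hA y).symm⟩

theorem Pχc_eq_zero {z : 𝔥} (hz : c.χc z = 0) : c.Pχc z = 0 := by
  have hsymm : ∀ x y : 𝔥, inner ℂ (c.χc x) y = inner ℂ x (c.χc y) := fun x y =>
    c.χc_pos.isSelfAdjoint.isSymmetric x y
  have hmem : z ∈ c.Kχcᗮ := by
    rw [Kχc, Submodule.orthogonal_closure, Submodule.mem_orthogonal]
    rintro _ ⟨y, rfl⟩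
    simpa [hz] using hsymm y z
  have hP : inner ℂ (c.Pχc z) (c.Pχc z) = inner ℂ (c.Pχc (c.Pχc z)) z :=
    (c.Pχc_sa.isSymmetric (c.Pχc z) z).symm
  rw [Submodule.inner_right_of_mem_orthogonal (c.Pχc_mem _) hmem] at hP
  exact inner_self_eq_zero.mp hP

theorem χc_sub_Pχc (x : 𝔥) : c.χc (x - c.Pχc x) = 0 := by
  have h : (1 - c.Pχc) ∘L c.χc = 0 := by
    ext y
    have hy : c.χc y ∈ c.Kχc := Submodule.le_topologicalClosure _ ⟨y, rfl⟩
    simp [c.Pχc_fix _ hy]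
  have h' := congrArg adjoint h
  rw [adjoint_comp, map_sub, c.Pχc_sa.adjoint_eq, c.χc_pos.isSelfAdjoint.adjoint_eq,
    map_zero, (IsSelfAdjoint.one (𝔥 →L[ℂ] 𝔥)).adjoint_eq] at h'
  simpa using congr($h' x)

theorem f_apply_of_mem {y : 𝔥} (hy : y ∈ c.Kχc) : c.f y = c.T (c.RΔ y) := by
  simp [f, c.Pχc_fix y hy]

theorem f_apply_of_χc_eq_zero {z : 𝔥} (hz : c.χc z = 0) : c.f z = z := by
  simp [f, c.Pχc_eq_zero hz]

theorem T_S_apply (x : 𝔥) : c.T (c.S x) = c.S (c.T x) := congr($(c.comm_TS) x)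

theorem T_χ_apply (x : 𝔥) : c.T (c.χ x) = c.χ (c.T x) := congr($(c.comm_Tχ) x)

theorem T_χc_apply (x : 𝔥) : c.T (c.χc x) = c.χc (c.T x) := congr($(c.comm_Tχc) x)

theorem S_χ_apply (x : 𝔥) : c.S (c.χ x) = c.χ (c.S x) := congr($(c.comm_Sχ) x)

theorem S_χc_apply (x : 𝔥) : c.S (c.χc x) = c.χc (c.S x) := congr($(c.comm_Sχc) x)

theorem χ_χc_apply (x : 𝔥) : c.χ (c.χc x) = c.χc (c.χ x) := congr($(c.comm_χχc) x)

theorem χ_χ_add_χc_χc_apply (x : 𝔥) : c.χ (c.χ x) + c.χc (c.χc x) = x :=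
  congr($(c.sum_sq) x)

theorem Delta_apply (x : 𝔥) :
    c.Delta x = c.T (c.χ (c.χ x)) + c.S (c.χc (c.χc x)) := rfl

/-- The identity on `𝔥_χ̄`, where `f` acts as `T Δ⁻¹`. -/
theorem add_χ_f_χ_apply_of_mem {y : 𝔥} (hy : y ∈ c.Kχc) :
    c.T y + c.χ (c.f ((c.S - c.T) (c.χ y))) = c.S (c.f y) := by
  have hχK : ∀ x ∈ c.Kχc, c.χ x ∈ c.Kχc := fun x => c.map_mem_Kχc c.χ_χc_apply
  have hSK : ∀ x ∈ c.Kχc, c.S x ∈ c.Kχc := fun x => c.map_mem_Kχc c.S_χc_apply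
  have hDK : ∀ x ∈ c.Kχc, (c.S - c.T) x ∈ c.Kχc := fun x =>
    c.map_mem_Kχc (fun z => by simp [c.S_χc_apply, c.T_χc_apply])
  have hinv : IsInvK c.Delta c.RΔ c.Kχc := c.invΔ
  have hΔχ : ∀ x, c.Delta (c.χ x) = c.χ (c.Delta x) := fun x => by
    simp [Delta_apply, ← c.T_χ_apply, ← c.S_χ_apply, c.χ_χc_apply]
  have hΔS : ∀ x, c.Delta (c.S x) = c.S (c.Delta x) := fun x => by
    simp [Delta_apply, ← c.T_S_apply, ← c.S_χ_apply, ← c.S_χc_apply]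
  have hsum : c.Delta y + c.χ ((c.S - c.T) (c.χ y)) = c.S y := by
    conv_rhs => rw [← c.χ_χ_add_χc_χc_apply y, map_add]
    simp only [Delta_apply, sub_apply, map_sub, c.T_χ_apply, c.S_χ_apply]
    abel
  have hD := hDK _ (hχK _ hy)
  rw [c.f_apply_of_mem hD, c.f_apply_of_mem hy, ← c.T_χ_apply,
    ← hinv.apply_comm hχK hΔχ hD, ← c.T_S_apply, ← hinv.apply_comm hSK hΔS hy, ← hsum,
    map_add, map_add, (hinv.2 y hy).2.2]

/-- The identity on `ker χ̄`, where `f` acts as `1`. -/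
theorem add_χ_f_χ_apply_of_χc_eq_zero {z : 𝔥} (hz : c.χc z = 0) :
    c.T z + c.χ (c.f ((c.S - c.T) (c.χ z))) = c.S (c.f z) := by
  have hD : c.χc ((c.S - c.T) (c.χ z)) = 0 := by
    simp [← c.S_χc_apply, ← c.T_χc_apply, ← c.χ_χc_apply, hz]
  have hsq := c.χ_χ_add_χc_χc_apply z
  rw [hz, map_zero, add_zero] at hsq
  rw [c.f_apply_of_χc_eq_zero hD, c.f_apply_of_χc_eq_zero hz]
  simp [← c.S_χ_apply, ← c.T_χ_apply, hsq]

end BddSetup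

/-- the free part of the smooth Feshbach–Schur map transforms as:
the restriction to `𝔥_χ` of `T − χ f_{χ,T}(S) W_S χ + χ f_{χ,T}(S) W_T χ` equals the
restriction to `𝔥_χ` of `S f_{χ,T}(S)`. -/
theorem free_part_identity (c : BddSetup 𝔥) :
    ∀ x ∈ c.Kχ,
      c.T x - c.χ (c.f (c.WS (c.χ x))) + c.χ (c.f (c.WT (c.χ x))) = c.S (c.f x) := by
  intro x _
  have hK := c.add_χ_f_χ_apply_of_mem (c.Pχc_mem x)
  have hker := c.add_χ_f_χ_apply_of_χc_eq_zero (c.χc_sub_Pχc x)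
  have hx : c.T x + c.χ (c.f ((c.S - c.T) (c.χ x))) = c.S (c.f x) := by
    have hsum := congr($hK + $hker)
    rwa [add_add_add_comm, ← map_add, ← map_add, ← map_add, ← map_add, ← map_add, ← map_add,
      ← map_add, add_sub_cancel] at hsum
  rw [← hx, sub_add, ← map_sub, ← map_sub, sub_eq_add_neg, ← map_neg, ← map_neg]
  congr 4
  simp [BddSetup.WS, BddSetup.WT]

end
end
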